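/- Let N, T, r be positive integers with r ≤ T, X a real T×N matrix, λ ≥ 0, D = I_N + λ Π_N, and W = X D⁻¹ Xᵀ. Let u₁,…,u_r be orthonormal eigenvectors of W corresponding to its r largest eigenvalues μ₁ ≥ … ≥ μ_r, and let F̂ be the T×r matrix whose i-th column is √T·u_i, with B̂ = T⁻¹ D⁻¹ Xᵀ F̂. Then F̂ᵀF̂ = T·I_r, and for every B ∈ ℝ^{N×r} and every F ∈ ℝ^{T×r} with FᵀF = T·I_r, L(B̂,F̂) ≤ L(B,F); moreover L(B̂,F̂) = (NT)⁻¹ Tr(XᵀX) − (NT)⁻¹ (μ₁ + … + μ_r). -/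

import Mathlib

open Matrix BigOperators

/-- The normalized Laplacian matrix `Π_N = I_N − (1/N) J_N`. -/
noncomputable def PiN (N : ℕ) : Matrix (Fin N) (Fin N) ℝ :=
  1 - (N : ℝ)⁻¹ • Matrix.of (fun _ _ => (1 : ℝ))

/-- The matrix `D = I_N + λ Π_N`. -/
noncomputable def Dmat (N : ℕ) (lam : ℝ) : Matrix (Fin N) (Fin N) ℝ :=
  1 + lam • PiN N

/-- The PPCA objective `L(B,F) = (TN)⁻¹‖X − FBᵀ‖_F² + (λ/N) Tr(Bᵀ Π_N B)`. -/
noncomputable def Lobj (N T r : ℕ) (lam : ℝ) (X : Matrix (Fin T) (Fin N) ℝ)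
    (B : Matrix (Fin N) (Fin r) ℝ) (F : Matrix (Fin T) (Fin r) ℝ) : ℝ :=
  ((T : ℝ) * (N : ℝ))⁻¹ * Matrix.trace ((X - F * Bᵀ)ᵀ * (X - F * Bᵀ))
    + (lam / (N : ℝ)) * Matrix.trace (Bᵀ * PiN N * B)

/-- The matrix `Π_N` is symmetric. -/
lemma PiN_transpose (N : ℕ) : (PiN N)ᵀ = PiN N := by
  ext i j
  simp [PiN, Matrix.one_apply, eq_comm]

/-- The matrix `Π_N` is idempotent. -/
lemma PiN_mul_self {N : ℕ} (hN : 0 < N) : PiN N * PiN N = PiN N := by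
  have hN' : (N : ℝ) ≠ 0 := by positivity
  have hJ : (Matrix.of (fun _ _ => (1 : ℝ)) : Matrix (Fin N) (Fin N) ℝ) *
      Matrix.of (fun _ _ => (1 : ℝ)) = (N : ℝ) • Matrix.of (fun _ _ => (1 : ℝ)) := by
    ext i j
    simp [Matrix.mul_apply]
  simp only [PiN, sub_mul, mul_sub, Matrix.mul_one, Matrix.one_mul, Matrix.smul_mul,
    Matrix.mul_smul, hJ, smul_smul]
  rw [inv_mul_cancel₀ hN', mul_one, sub_self, sub_zero]

lemma PiN_posSemidef {N : ℕ} (hN : 0 < N) : (PiN N).PosSemidef := by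
  have h := Matrix.posSemidef_conjTranspose_mul_self (PiN N)
  rwa [Matrix.conjTranspose_eq_transpose_of_trivial, PiN_transpose, PiN_mul_self hN] at h

lemma Dmat_posDef {N : ℕ} (hN : 0 < N) {lam : ℝ} (hlam : 0 ≤ lam) : (Dmat N lam).PosDef :=
  Matrix.PosDef.one.add_posSemidef ((PiN_posSemidef hN).smul hlam)

lemma Dmat_transpose (N : ℕ) (lam : ℝ) : (Dmat N lam)ᵀ = Dmat N lam := by
  simp [Dmat, PiN_transpose]

/-- Completing the square in `B`: the objective splits into a part depending on `F` only and a
quadratic form in `B - T⁻¹ D⁻¹ Xᵀ F`. -/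
lemma Lobj_eq_complete_square {N T r : ℕ} (hN : 0 < N) (hT : 0 < T) {lam : ℝ} (hlam : 0 ≤ lam)
    (X : Matrix (Fin T) (Fin N) ℝ) (B : Matrix (Fin N) (Fin r) ℝ) (F : Matrix (Fin T) (Fin r) ℝ)
    (hF : Fᵀ * F = (T : ℝ) • (1 : Matrix (Fin r) (Fin r) ℝ)) :
    Lobj N T r lam X B F = ((N : ℝ) * (T : ℝ))⁻¹ * (trace (Xᵀ * X)
      - (T : ℝ)⁻¹ * trace (Fᵀ * (X * (Dmat N lam)⁻¹ * Xᵀ) * F)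
      + T * trace ((B - (T : ℝ)⁻¹ • ((Dmat N lam)⁻¹ * Xᵀ * F))ᵀ * Dmat N lam
          * (B - (T : ℝ)⁻¹ • ((Dmat N lam)⁻¹ * Xᵀ * F)))) := by
  have hN' : (N : ℝ) ≠ 0 := by positivity
  have hT' : (T : ℝ) ≠ 0 := by positivity
  have hdet : IsUnit (Dmat N lam).det := (Dmat_posDef hN hlam).det_pos.ne'.isUnit
  have hinvT : ((Dmat N lam)⁻¹)ᵀ = (Dmat N lam)⁻¹ := by
    rw [Matrix.transpose_nonsing_inv, Dmat_transpose]
  have hcross : trace (Xᵀ * (F * Bᵀ)) = trace (Bᵀ * (Xᵀ * F)) := by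
    rw [← Matrix.mul_assoc, Matrix.trace_mul_comm]
  have hcross' : trace (B * Fᵀ * X) = trace (Bᵀ * (Xᵀ * F)) := by
    rw [← Matrix.trace_transpose]
    simp only [Matrix.transpose_mul, Matrix.transpose_transpose]
    exact hcross
  have hquad : trace (B * Fᵀ * (F * Bᵀ)) = T * trace (Bᵀ * B) := by
    rw [Matrix.mul_assoc, ← Matrix.mul_assoc Fᵀ, hF, Matrix.trace_mul_comm]
    simp
  have hfit : trace ((X - F * Bᵀ)ᵀ * (X - F * Bᵀ)) =
      trace (Xᵀ * X) - 2 * trace (Bᵀ * (Xᵀ * F)) + T * trace (Bᵀ * B) := by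
    simp only [Matrix.transpose_sub, Matrix.transpose_mul, Matrix.transpose_transpose,
      Matrix.sub_mul, Matrix.mul_sub, Matrix.trace_sub, hcross, hcross', hquad]
    ring
  have hD : trace (Bᵀ * Dmat N lam * B) = trace (Bᵀ * B) + lam * trace (Bᵀ * PiN N * B) := by
    simp [Dmat, Matrix.mul_add, Matrix.add_mul]
  have hmix : trace (Fᵀ * (X * B)) = trace (Bᵀ * (Xᵀ * F)) := by
    rw [← Matrix.trace_transpose]
    simp [Matrix.transpose_mul, Matrix.mul_assoc]
  have hsq : trace ((B - (T : ℝ)⁻¹ • ((Dmat N lam)⁻¹ * Xᵀ * F))ᵀ * Dmat N lam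
        * (B - (T : ℝ)⁻¹ • ((Dmat N lam)⁻¹ * Xᵀ * F))) =
      trace (Bᵀ * Dmat N lam * B) - 2 * (T : ℝ)⁻¹ * trace (Bᵀ * (Xᵀ * F))
        + (T : ℝ)⁻¹ * (T : ℝ)⁻¹ * trace (Fᵀ * (X * (Dmat N lam)⁻¹ * Xᵀ) * F) := by
    simp only [Matrix.transpose_sub, Matrix.transpose_smul, Matrix.transpose_mul,
      Matrix.transpose_transpose, hinvT, Matrix.sub_mul, Matrix.mul_sub, Matrix.smul_mul, Matrix.mul_smul,
      Matrix.trace_sub, Matrix.trace_smul, smul_eq_mul, Matrix.mul_assoc,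
      Matrix.nonsing_inv_mul_cancel_left _ _ hdet, Matrix.mul_nonsing_inv_cancel_left _ _ hdet,
      hmix]
    ring
  rw [Lobj, hfit, hsq, hD]
  field_simp
  ring

/-- The leverage scores of a matrix with orthonormal columns are at most one. -/
lemma sum_sq_row_le_one {m n : Type*} [Fintype m] [Fintype n] [DecidableEq m] [DecidableEq n]
    (V : Matrix m n ℝ) (hV : Vᵀ * V = 1) (t : m) : ∑ i, V t i ^ 2 ≤ 1 := by
  have hproj : (1 - V * Vᵀ)ᵀ * (1 - V * Vᵀ) = 1 - V * Vᵀ := by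
    have h : V * Vᵀ * (V * Vᵀ) = V * Vᵀ := by
      rw [Matrix.mul_assoc, ← Matrix.mul_assoc Vᵀ, hV, Matrix.one_mul]
    simp [sub_mul, mul_sub, h]
  have h0 : 0 ≤ ((1 - V * Vᵀ)ᵀ * (1 - V * Vᵀ) : Matrix m m ℝ) t t := by
    rw [Matrix.mul_apply]
    exact Finset.sum_nonneg fun i _ => mul_self_nonneg _
  rw [hproj] at h0
  simpa [Matrix.mul_apply, ← sq] using h0

lemma trace_transpose_mul_diagonal_mul {m n : Type*} [Fintype m] [Fintype n] [DecidableEq m]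
    (V : Matrix m n ℝ) (d : m → ℝ) :
    trace (Vᵀ * diagonal d * V) = ∑ t, d t * ∑ i, V t i ^ 2 := by
  simp only [Matrix.trace, Matrix.diag, Matrix.mul_apply (M := Vᵀ * diagonal d),
    Matrix.mul_diagonal, Matrix.transpose_apply, Finset.mul_sum]
  rw [Finset.sum_comm]
  exact Finset.sum_congr rfl fun t _ => Finset.sum_congr rfl fun i _ => by ring

lemma sum_castLE_eq_sum_ite {r T : ℕ} (hrT : r ≤ T) (f : Fin T → ℝ) :
    ∑ i : Fin r, f (Fin.castLE hrT i) = ∑ t : Fin T, if (t : ℕ) < r then f t else 0 := by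
  obtain ⟨k, rfl⟩ := Nat.exists_eq_add_of_le hrT
  rw [Fin.sum_univ_add]
  simp [Fin.castAdd]

/-- Ky Fan's inequality for a diagonal matrix with decreasing entries. -/
lemma trace_diagonal_le_sum_castLE {r T : ℕ} (hr : 0 < r) (hrT : r ≤ T) {mu : Fin T → ℝ}
    (hmono : Antitone mu) (V : Matrix (Fin T) (Fin r) ℝ) (hV : Vᵀ * V = 1) :
    trace (Vᵀ * diagonal mu * V) ≤ ∑ i : Fin r, mu (Fin.castLE hrT i) := by
  rw [trace_transpose_mul_diagonal_mul]
  have htotal : ∑ t, ∑ i, V t i ^ 2 = (r : ℝ) := by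
    have h := trace_transpose_mul_diagonal_mul V (fun _ => 1)
    rw [Matrix.diagonal_one, Matrix.mul_one, hV] at h
    simpa using h.symm
  let k : Fin T := ⟨r - 1, by omega⟩
  have hbound : ∑ t, (mu t - mu k) * ∑ i, V t i ^ 2 ≤
      ∑ i : Fin r, (mu (Fin.castLE hrT i) - mu k) := by
    rw [sum_castLE_eq_sum_ite hrT (fun t => mu t - mu k)]
    refine Finset.sum_le_sum fun t _ => ?_
    split_ifs with ht
    · have hk : mu k ≤ mu t := hmono (Fin.le_def.2 (show (t : ℕ) ≤ r - 1 by omega))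
      exact mul_le_of_le_one_right (sub_nonneg.2 hk) (sum_sq_row_le_one V hV t)
    · have hk : mu t ≤ mu k := hmono (Fin.le_def.2 (show r - 1 ≤ (t : ℕ) by omega))
      exact mul_nonpos_of_nonpos_of_nonneg (sub_nonpos.2 hk)
        (Finset.sum_nonneg fun i _ => sq_nonneg _)
  simp only [sub_mul, Finset.sum_sub_distrib, ← Finset.mul_sum, htotal, Finset.sum_const,
    Finset.card_univ, Fintype.card_fin, nsmul_eq_mul] at hbound
  linarith

/-- Ky Fan's inequality for a matrix given by its spectral decomposition. -/
lemma trace_conj_le_sum_castLE {r T : ℕ} (hr : 0 < r) (hrT : r ≤ T) {mu : Fin T → ℝ}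
    (hmono : Antitone mu) {U : Matrix (Fin T) (Fin T) ℝ} (hU : Uᵀ * U = 1)
    (F : Matrix (Fin T) (Fin r) ℝ)
    (hF : Fᵀ * F = (T : ℝ) • (1 : Matrix (Fin r) (Fin r) ℝ)) :
    (T : ℝ)⁻¹ * trace (Fᵀ * (U * diagonal mu * Uᵀ) * F) ≤
      ∑ i : Fin r, mu (Fin.castLE hrT i) := by
  have hT' : (0 : ℝ) < T := by exact_mod_cast hr.trans_le hrT
  have hs : (√(T : ℝ))⁻¹ * (√(T : ℝ))⁻¹ = (T : ℝ)⁻¹ := by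
    rw [← mul_inv, Real.mul_self_sqrt hT'.le]
  have hU' : U * Uᵀ = 1 := mul_eq_one_comm.1 hU
  have hV : ((√(T : ℝ))⁻¹ • (Uᵀ * F))ᵀ * ((√(T : ℝ))⁻¹ • (Uᵀ * F)) = 1 := by
    have h : Fᵀ * U * (Uᵀ * F) = (T : ℝ) • 1 := by
      rw [Matrix.mul_assoc, ← Matrix.mul_assoc U, hU', Matrix.one_mul, hF]
    simp only [Matrix.transpose_smul, Matrix.transpose_mul, Matrix.transpose_transpose,
      Matrix.smul_mul, Matrix.mul_smul, h, smul_smul]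
    rw [← mul_assoc, hs, inv_mul_cancel₀ hT'.ne', one_smul]
  have h := trace_diagonal_le_sum_castLE hr hrT hmono _ hV
  simpa only [Matrix.transpose_smul, Matrix.transpose_mul, Matrix.transpose_transpose,
    Matrix.smul_mul, Matrix.mul_smul, smul_smul, hs, Matrix.trace_smul, smul_eq_mul,
    Matrix.mul_assoc] using h

/-- Let `W = X D⁻¹ Xᵀ` have spectral decomposition `W = U diag(μ) Uᵀ` with `U`
orthogonal and `μ₁ ≥ … ≥ μ_T` (so the first `r` columns of `U` are orthonormal eigenvectors for
the `r` largest eigenvalues). Let `F̂` have `i`-th column `√T·u_i` and `B̂ = T⁻¹ D⁻¹ Xᵀ F̂`.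
Then `F̂ᵀF̂ = T·I_r`, the pair `(B̂, F̂)` minimizes the PPCA objective `L` over all `B` and all
`F` with `FᵀF = T·I_r`, and `L(B̂,F̂) = (NT)⁻¹Tr(XᵀX) − (NT)⁻¹(μ₁ + … + μ_r)`. -/
theorem ppca_global_minimizer (N T r : ℕ) (hN : 0 < N) (hT : 0 < T) (hr : 0 < r) (hrT : r ≤ T)
    (X : Matrix (Fin T) (Fin N) ℝ) (lam : ℝ) (hlam : 0 ≤ lam)
    (W U : Matrix (Fin T) (Fin T) ℝ) (mu : Fin T → ℝ)
    (hWdef : W = X * (Dmat N lam)⁻¹ * Xᵀ)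
    (hU : Uᵀ * U = 1) (hmono : Antitone mu)
    (hspec : W = U * Matrix.diagonal mu * Uᵀ)
    (Fhat : Matrix (Fin T) (Fin r) ℝ)
    (hFhat : ∀ (t : Fin T) (i : Fin r), Fhat t i = Real.sqrt T * U t (Fin.castLE hrT i))
    (Bhat : Matrix (Fin N) (Fin r) ℝ)
    (hBhat : Bhat = (T : ℝ)⁻¹ • ((Dmat N lam)⁻¹ * Xᵀ * Fhat)) :
    Fhatᵀ * Fhat = (T : ℝ) • (1 : Matrix (Fin r) (Fin r) ℝ) ∧
    (∀ (B : Matrix (Fin N) (Fin r) ℝ) (F : Matrix (Fin T) (Fin r) ℝ),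
      Fᵀ * F = (T : ℝ) • (1 : Matrix (Fin r) (Fin r) ℝ) →
        Lobj N T r lam X Bhat Fhat ≤ Lobj N T r lam X B F) ∧
    Lobj N T r lam X Bhat Fhat =
      ((N : ℝ) * (T : ℝ))⁻¹ * Matrix.trace (Xᵀ * X)
        - ((N : ℝ) * (T : ℝ))⁻¹ * ∑ i : Fin r, mu (Fin.castLE hrT i) := by
  have hT' : (0 : ℝ) < T := by exact_mod_cast hT
  have hs : √(T : ℝ) * √(T : ℝ) = T := Real.mul_self_sqrt hT'.le
  let E : Matrix (Fin T) (Fin r) ℝ := (1 : Matrix (Fin T) (Fin T) ℝ).submatrix id (Fin.castLE hrT)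
  have hE : Fhat = √(T : ℝ) • (U * E) := by
    ext t i
    simp [hFhat, E, Matrix.mul_apply, Matrix.one_apply]
  have hEE : Eᵀ * E = 1 := by
    ext i j
    simp [E, Matrix.mul_apply, Matrix.one_apply, (Fin.castLE_injective hrT).eq_iff, eq_comm]
  have hFF : Fhatᵀ * Fhat = (T : ℝ) • (1 : Matrix (Fin r) (Fin r) ℝ) := by
    have h : Eᵀ * Uᵀ * (U * E) = 1 := by
      rw [Matrix.mul_assoc, ← Matrix.mul_assoc Uᵀ, hU, Matrix.one_mul, hEE]
    rw [hE]
    simp [Matrix.transpose_mul, smul_smul, hs, h]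
  have htr : (T : ℝ)⁻¹ * trace (Fhatᵀ * (U * diagonal mu * Uᵀ) * Fhat) =
      ∑ i : Fin r, mu (Fin.castLE hrT i) := by
    have h : Eᵀ * Uᵀ * (U * diagonal mu * Uᵀ) * (U * E) = Eᵀ * diagonal mu * E := by
      calc Eᵀ * Uᵀ * (U * diagonal mu * Uᵀ) * (U * E)
          = Eᵀ * (Uᵀ * U) * diagonal mu * (Uᵀ * U) * E := by simp only [Matrix.mul_assoc]
        _ = Eᵀ * diagonal mu * E := by simp [hU]
    have hdiag : trace (Eᵀ * diagonal mu * E) = ∑ i : Fin r, mu (Fin.castLE hrT i) := by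
      simp [E, Matrix.trace, Matrix.mul_apply, Matrix.one_apply, Matrix.diagonal_apply]
    rw [hE]
    simp only [Matrix.transpose_smul, Matrix.transpose_mul, Matrix.smul_mul, Matrix.mul_smul, h,
      smul_smul, hs, Matrix.trace_smul, smul_eq_mul, hdiag]
    rw [← mul_assoc, inv_mul_cancel₀ hT'.ne', one_mul]
  have hval : Lobj N T r lam X Bhat Fhat =
      ((N : ℝ) * (T : ℝ))⁻¹ * Matrix.trace (Xᵀ * X)
        - ((N : ℝ) * (T : ℝ))⁻¹ * ∑ i : Fin r, mu (Fin.castLE hrT i) := by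
    rw [Lobj_eq_complete_square hN hT hlam X Bhat Fhat hFF, ← hBhat, ← hWdef, hspec, htr]
    simp [mul_sub]
  refine ⟨hFF, fun B F hF => ?_, hval⟩
  rw [hval, Lobj_eq_complete_square hN hT hlam X B F hF, ← mul_sub, ← hWdef, hspec]
  refine mul_le_mul_of_nonneg_left ?_ (by positivity)
  have hky := trace_conj_le_sum_castLE hr hrT hmono hU F hF
  have hnonneg := ((Dmat_posDef hN hlam).posSemidef.conjTranspose_mul_mul_same
    (B - (T : ℝ)⁻¹ • ((Dmat N lam)⁻¹ * Xᵀ * F))).trace_nonneg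
  rw [Matrix.conjTranspose_eq_transpose_of_trivial] at hnonneg
  have := mul_nonneg hT'.le hnonneg
  linarith
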